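/- arXiv:2311.02614 — 7 statements merged into one kernel-verified Lean document; each statement's English description precedes it below -/
import Mathlib

section
/- First variation formula (Lagrangian side, single smooth interval). Define, for ε in a neighborhood of 0 small enough that α_T' + ε·δα_T' > 0 on [a, b], S(ε) = ∫_a^b [L(α_Q + ε·δα_Q, ν + ε·δν) + (π + ε·δπ)·((α_Q' + ε·δα_Q')/(α_T' + ε·δα_T') − (ν + ε·δν))]·(α_T' + ε·δα_T') dτ. Then S is differentiable at ε = 0 and S'(0) = ∫_a^b [ (α_T'·(∂L/∂q)(α_Q, ν) − π')·δα_Q − (d/dτ)[L(α_Q, ν) − π·ν]·δα_T + α_T'·((∂L/∂v)(α_Q, ν) − π)·δν + δπ·(α_Q' − α_T'·ν) ] dτ + [π·δα_Q + (L(α_Q, ν) − π·ν)·δα_T]_{τ=a}^{τ=b}, where [F]_{τ=a}^{τ=b} = F(b) − F(a). -/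
open Set

/-- A function continuous on `s`, viewed as a function of two variables independent of the first,
is continuous on `univ ×ˢ s`. -/
theorem ContinuousOn.comp_snd_univ {X Y Z : Type*} [TopologicalSpace X] [TopologicalSpace Y]
    [TopologicalSpace Z] {f : Y → Z} {s : Set Y} (hf : ContinuousOn f s) :
    ContinuousOn (fun p : X × Y => f p.2) (univ ×ˢ s) :=
  hf.comp continuousOn_snd fun _ hp => hp.2

open MeasureTheory in
/-- Differentiation under the integral sign over a compact interval, for an integrand which is
jointly continuous together with its derivative in the parameter. -/
theorem hasDerivAt_intervalIntegral_of_continuousOn {E : Type*} [NormedAddCommGroup E]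
    [NormedSpace ℝ E] {F F' : ℝ → ℝ → E} {a b x₀ : ℝ}
    (hF : ContinuousOn (fun p : ℝ × ℝ => F p.1 p.2) (univ ×ˢ uIcc a b))
    (hF' : ContinuousOn (fun p : ℝ × ℝ => F' p.1 p.2) (univ ×ˢ uIcc a b))
    (hderiv : ∀ x, ∀ t ∈ uIcc a b, HasDerivAt (fun y => F y t) (F' x t) x) :
    HasDerivAt (fun x => ∫ t in a..b, F x t) (∫ t in a..b, F' x₀ t) x₀ := by
  have slice : ∀ {G : ℝ → ℝ → E},
      ContinuousOn (fun p : ℝ × ℝ => G p.1 p.2) (univ ×ˢ uIcc a b) →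
      ∀ x, ContinuousOn (G x) (uIcc a b) := fun hG x =>
    hG.comp (f := fun t => (x, t)) (by fun_prop) fun t ht => ⟨mem_univ x, ht⟩
  have meas : ∀ {G : ℝ → ℝ → E},
      ContinuousOn (fun p : ℝ × ℝ => G p.1 p.2) (univ ×ˢ uIcc a b) →
      ∀ x, AEStronglyMeasurable (G x) (volume.restrict (uIoc a b)) := fun hG x =>
    (slice hG x).intervalIntegrable.def'.aestronglyMeasurable
  obtain ⟨C, hC⟩ := ((isCompact_closedBall x₀ 1).prod (isCompact_uIcc (a := a) (b := b)))
    |>.exists_bound_of_continuousOn (hF'.mono (prod_mono_left (subset_univ _)))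
  refine (intervalIntegral.hasDerivAt_integral_of_dominated_loc_of_deriv_le
    (bound := fun _ => C) (Metric.closedBall_mem_nhds x₀ one_pos)
    (Filter.Eventually.of_forall (meas hF)) (slice hF x₀).intervalIntegrable (meas hF' x₀)
    (Filter.Eventually.of_forall fun t ht x hx => hC (x, t) ⟨hx, uIoc_subset_uIcc ht⟩)
    intervalIntegrable_const
    (Filter.Eventually.of_forall fun t ht x _ => hderiv x t (uIoc_subset_uIcc ht))).2

/-- A function with a continuous one-sided derivative on a nontrivial compact interval is `C¹`. -/
theorem contDiffOn_one_Icc_of_hasDerivWithinAt {E : Type*} [NormedAddCommGroup E]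
    [NormedSpace ℝ E] {f f' : ℝ → E} {a b : ℝ} (hab : a < b)
    (hf : ∀ t ∈ Icc a b, HasDerivWithinAt f (f' t) (Icc a b) t)
    (hf' : ContinuousOn f' (Icc a b)) : ContDiffOn ℝ 1 f (Icc a b) :=
  (contDiffOn_one_iff_derivWithin (uniqueDiffOn_Icc hab)).2
    ⟨fun t ht => (hf t ht).differentiableWithinAt,
      hf'.congr fun t ht => (hf t ht).derivWithin (uniqueDiffOn_Icc hab t ht)⟩

/-- The derivative of a differentiable function of two variables is the sum of its partial derivatives. -/
theorem fderiv_prod_apply_of_partial {𝕜 E F G : Type*} [NontriviallyNormedField 𝕜]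
    [NormedAddCommGroup E] [NormedSpace 𝕜 E] [NormedAddCommGroup F] [NormedSpace 𝕜 F]
    [NormedAddCommGroup G] [NormedSpace 𝕜 G] {f : E → F → G} {x : E} {y : F}
    {fx : E →L[𝕜] G} {fy : F →L[𝕜] G}
    (hf : DifferentiableAt 𝕜 (fun p : E × F => f p.1 p.2) (x, y))
    (hx : HasFDerivAt (fun x' => f x' y) fx x) (hy : HasFDerivAt (fun y' => f x y') fy y)
    (u : E) (w : F) :
    fderiv 𝕜 (fun p : E × F => f p.1 p.2) (x, y) (u, w) = fx u + fy w := by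
  have h1 := hx.unique (HasFDerivAt.comp (f := fun x' => (x', y)) x hf.hasFDerivAt
    (hasFDerivAt_prodMk_left x y))
  have h2 := hy.unique (HasFDerivAt.comp (f := fun y' => (x, y')) y hf.hasFDerivAt
    (hasFDerivAt_prodMk_right x y))
  rw [h1, h2]
  simp [← map_add]

/-- If `f` is positive on a compact set, then `f + ε g` has no zero on it for all `ε` near `0`. -/
theorem eventually_forall_add_mul_ne_zero {X : Type*} [TopologicalSpace X] {K : Set X}
    (hK : IsCompact K) {f g : X → ℝ} (hf : ContinuousOn f K) (hg : ContinuousOn g K)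
    (hpos : ∀ t ∈ K, 0 < f t) : ∀ᶠ ε : ℝ in nhds 0, ∀ t ∈ K, f t + ε * g t ≠ 0 := by
  obtain ⟨C, hC⟩ := hK.exists_bound_of_continuousOn (hg.div hf fun t ht => (hpos t ht).ne')
  have hlim : Filter.Tendsto (fun ε : ℝ => |ε| * C) (nhds 0) (nhds 0) := by
    have : Continuous fun ε : ℝ => |ε| * C := by fun_prop
    simpa using this.tendsto 0
  filter_upwards [hlim.eventually_lt_const one_pos] with ε hε t ht h0
  have hft := (hpos t ht).ne'
  have h1 : ε * (g t / f t) = -1 := by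
    field_simp
    linarith
  have h2 : |ε| * |g t / f t| = 1 := by rw [← abs_mul, h1]; simp
  have h3 := mul_le_mul_of_nonneg_left (hC t ht) (abs_nonneg ε)
  simp only [Pi.div_apply, Real.norm_eq_abs] at h3
  linarith

/-- **First variation formula (Lagrangian side, single smooth interval).**
`V` is a finite-dimensional real normed vector space and `L : V × V → ℝ` a `C¹`
Lagrangian with partial derivatives `Lq = ∂L/∂q`, `Lv = ∂L/∂v`.  On `[a, b]`, the curves
`αT` (with `αT' > 0`), `αQ`, `ν`, `π` and the variations `δαT`, `δαQ`, `δν`, `δπ` are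
`C¹` (with the indicated derivatives), and `e'` is the derivative of the energy-type
quantity `τ ↦ L(αQ, ν) − π·ν`.  Then the action
`S(ε) = ∫_a^b [L(αQ + ε δαQ, ν + ε δν)
        + (π + ε δπ)·((αQ' + ε δαQ')/(αT' + ε δαT') − (ν + ε δν))]·(αT' + ε δαT') dτ`
is differentiable at `ε = 0` with
`S'(0) = ∫_a^b [(αT'·∂L/∂q − π')·δαQ − e'·δαT + αT'·(∂L/∂v − π)·δν
        + δπ·(αQ' − αT'·ν)] dτ + [π·δαQ + (L(αQ, ν) − π·ν)·δαT]_{τ=a}^{τ=b}`. -/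
theorem first_variation_lagrangian
    {V : Type*} [NormedAddCommGroup V] [NormedSpace ℝ V] [FiniteDimensional ℝ V]
    (L : V → V → ℝ) (Lq Lv : V → V → (V →L[ℝ] ℝ))
    (hLC1 : ContDiff ℝ 1 fun qv : V × V => L qv.1 qv.2)
    (hLq : ∀ q v, HasFDerivAt (fun q' => L q' v) (Lq q v) q)
    (hLv : ∀ q v, HasFDerivAt (fun v' => L q v') (Lv q v) v)
    (a b : ℝ) (hab : a < b)
    (αT αT' δαT δαT' : ℝ → ℝ) (αQ αQ' ν δαQ δαQ' δν : ℝ → V)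
    (π π' δπ : ℝ → (V →L[ℝ] ℝ)) (e' : ℝ → ℝ)
    -- the curves and the variations are C¹ on [a, b]
    (hαT : ∀ τ ∈ Icc a b, HasDerivWithinAt αT (αT' τ) (Icc a b) τ)
    (hαT' : ContinuousOn αT' (Icc a b))
    (hαTpos : ∀ τ ∈ Icc a b, 0 < αT' τ)
    (hαQ : ∀ τ ∈ Icc a b, HasDerivWithinAt αQ (αQ' τ) (Icc a b) τ)
    (hαQ' : ContinuousOn αQ' (Icc a b))
    (hν : ContDiffOn ℝ 1 ν (Icc a b))
    (hπ : ∀ τ ∈ Icc a b, HasDerivWithinAt π (π' τ) (Icc a b) τ)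
    (hπ' : ContinuousOn π' (Icc a b))
    (hδαT : ∀ τ ∈ Icc a b, HasDerivWithinAt δαT (δαT' τ) (Icc a b) τ)
    (hδαT' : ContinuousOn δαT' (Icc a b))
    (hδαQ : ∀ τ ∈ Icc a b, HasDerivWithinAt δαQ (δαQ' τ) (Icc a b) τ)
    (hδαQ' : ContinuousOn δαQ' (Icc a b))
    (hδν : ContDiffOn ℝ 1 δν (Icc a b))
    (hδπ : ContDiffOn ℝ 1 δπ (Icc a b))
    -- e' is the derivative of τ ↦ L(αQ(τ), ν(τ)) − π(τ)·ν(τ)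
    (he' : ∀ τ ∈ Icc a b,
      HasDerivWithinAt (fun σ => L (αQ σ) (ν σ) - π σ (ν σ)) (e' τ) (Icc a b) τ) :
    HasDerivAt (fun ε : ℝ => ∫ τ in a..b,
        (L (αQ τ + ε • δαQ τ) (ν τ + ε • δν τ) +
          (π τ + ε • δπ τ)
            ((αT' τ + ε * δαT' τ)⁻¹ • (αQ' τ + ε • δαQ' τ) - (ν τ + ε • δν τ))) *
        (αT' τ + ε * δαT' τ))
      ((∫ τ in a..b,
          (αT' τ • Lq (αQ τ) (ν τ) - π' τ) (δαQ τ) - e' τ * δαT τ +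
            αT' τ * (Lv (αQ τ) (ν τ) - π τ) (δν τ) +
            δπ τ (αQ' τ - αT' τ • ν τ)) +
        (π b (δαQ b) + (L (αQ b) (ν b) - π b (ν b)) * δαT b) -
        (π a (δαQ a) + (L (αQ a) (ν a) - π a (ν a)) * δαT a))
      0 := by
  have hL : Differentiable ℝ fun qv : V × V => L qv.1 qv.2 := hLC1.differentiable one_ne_zero
  have hLcont : Continuous fun qv : V × V => L qv.1 qv.2 := hLC1.continuous
  have hDL : Continuous (fderiv ℝ fun qv : V × V => L qv.1 qv.2) :=
    hLC1.continuous_fderiv one_ne_zero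
  have hfd := fun q v => fderiv_prod_apply_of_partial (hL (q, v)) (hLq q v) (hLv q v)
  have hU := uniqueDiffOn_Icc hab
  have huIcc : uIcc a b = Icc a b := uIcc_of_le hab.le
  have cαQ : ContinuousOn αQ (Icc a b) := fun τ hτ => (hαQ τ hτ).continuousWithinAt
  have cπ : ContinuousOn π (Icc a b) := fun τ hτ => (hπ τ hτ).continuousWithinAt
  have cδαT : ContinuousOn δαT (Icc a b) := fun τ hτ => (hδαT τ hτ).continuousWithinAt
  have cδαQ : ContinuousOn δαQ (Icc a b) := fun τ hτ => (hδαQ τ hτ).continuousWithinAt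
  have cν := hν.continuousOn
  have cδν := hδν.continuousOn
  have cδπ := hδπ.continuousOn
  -- the energy is `C¹`
  have he_C1 : ContDiffOn ℝ 1 (fun σ => L (αQ σ) (ν σ) - π σ (ν σ)) (Icc a b) :=
    (hLC1.comp_contDiffOn
      ((contDiffOn_one_Icc_of_hasDerivWithinAt hab hαQ hαQ').prodMk hν)).sub
      ((contDiffOn_one_Icc_of_hasDerivWithinAt hab hπ hπ').clm_apply hν)
  have ce' : ContinuousOn e' (Icc a b) :=
    (he_C1.continuousOn_derivWithin hU le_rfl).congr
      fun τ hτ => ((he' τ hτ).derivWithin (hU τ hτ)).symm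
  -- the integrand, cleared of its denominator, and its derivative in the parameter
  set G : ℝ → ℝ → ℝ := fun ε τ =>
    (L (αQ τ + ε • δαQ τ) (ν τ + ε • δν τ) - (π τ + ε • δπ τ) (ν τ + ε • δν τ)) *
      (αT' τ + ε * δαT' τ) + (π τ + ε • δπ τ) (αQ' τ + ε • δαQ' τ) with hG
  set G' : ℝ → ℝ → ℝ := fun ε τ =>
    (fderiv ℝ (fun qv : V × V => L qv.1 qv.2) (αQ τ + ε • δαQ τ, ν τ + ε • δν τ)
        (δαQ τ, δν τ) -
      (δπ τ (ν τ + ε • δν τ) + (π τ + ε • δπ τ) (δν τ))) * (αT' τ + ε * δαT' τ) +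
    (L (αQ τ + ε • δαQ τ) (ν τ + ε • δν τ) - (π τ + ε • δπ τ) (ν τ + ε • δν τ)) * δαT' τ +
    (δπ τ (αQ' τ + ε • δαQ' τ) + (π τ + ε • δπ τ) (δαQ' τ)) with hG'
  have hGG' : ∀ ε, ∀ τ ∈ uIcc a b, HasDerivAt (fun x => G x τ) (G' ε τ) ε := by
    intro ε τ _
    have line : ∀ {E : Type _} [NormedAddCommGroup E] [NormedSpace ℝ E] (x y : E),
        HasDerivAt (fun ε : ℝ => x + ε • y) y ε := fun x y => by
      simpa using ((hasDerivAt_id ε).smul_const y).const_add x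
    have hLd := (hL (αQ τ + ε • δαQ τ, ν τ + ε • δν τ)).hasFDerivAt.comp_hasDerivAt ε
      ((line (αQ τ) (δαQ τ)).prodMk (line (ν τ) (δν τ)))
    have hT : HasDerivAt (fun ε : ℝ => αT' τ + ε * δαT' τ) (δαT' τ) ε := by
      simpa using ((hasDerivAt_id ε).mul_const (δαT' τ)).const_add (αT' τ)
    have hp : HasDerivAt (fun ε : ℝ => π τ + ε • δπ τ) (δπ τ) ε := by
      simpa using ((hasDerivAt_id ε).smul_const (δπ τ)).const_add (π τ)
    exact ((hLd.sub (hp.clm_apply (line (ν τ) (δν τ)))).mul hT).add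
      (hp.clm_apply (line (αQ' τ) (δαQ' τ)))
  have jT := (hαT'.comp_snd_univ (X := ℝ)).add (continuousOn_fst.mul hδαT'.comp_snd_univ)
  have jQ := (cαQ.comp_snd_univ (X := ℝ)).add (continuousOn_fst.smul cδαQ.comp_snd_univ)
  have jQ' := (hαQ'.comp_snd_univ (X := ℝ)).add (continuousOn_fst.smul hδαQ'.comp_snd_univ)
  have jν := (cν.comp_snd_univ (X := ℝ)).add (continuousOn_fst.smul cδν.comp_snd_univ)
  have jπ := (cπ.comp_snd_univ (X := ℝ)).add (continuousOn_fst.smul cδπ.comp_snd_univ)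
  have je := (hLcont.comp_continuousOn (jQ.prodMk jν)).sub (jπ.clm_apply jν)
  have hGcont : ContinuousOn (fun p : ℝ × ℝ => G p.1 p.2) (univ ×ˢ Icc a b) :=
    (je.mul jT).add (jπ.clm_apply jQ')
  have hG'cont : ContinuousOn (fun p : ℝ × ℝ => G' p.1 p.2) (univ ×ˢ Icc a b) :=
    (((((hDL.comp_continuousOn (jQ.prodMk jν)).clm_apply
      (cδαQ.comp_snd_univ.prodMk cδν.comp_snd_univ)).sub
      ((cδπ.comp_snd_univ.clm_apply jν).add (jπ.clm_apply cδν.comp_snd_univ))).mul jT).add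
      (je.mul hδαT'.comp_snd_univ)).add
      ((cδπ.comp_snd_univ.clm_apply jQ').add (jπ.clm_apply hδαQ'.comp_snd_univ))
  have key := hasDerivAt_intervalIntegral_of_continuousOn (x₀ := 0)
    (huIcc ▸ hGcont) (huIcc ▸ hG'cont) hGG'
  have hSG : (fun ε : ℝ => ∫ τ in a..b,
        (L (αQ τ + ε • δαQ τ) (ν τ + ε • δν τ) +
          (π τ + ε • δπ τ)
            ((αT' τ + ε * δαT' τ)⁻¹ • (αQ' τ + ε • δαQ' τ) - (ν τ + ε • δν τ))) *
        (αT' τ + ε * δαT' τ)) =ᶠ[nhds 0] fun ε => ∫ τ in a..b, G ε τ := by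
    filter_upwards [eventually_forall_add_mul_ne_zero isCompact_Icc hαT' hδαT' hαTpos]
      with ε hε
    refine intervalIntegral.integral_congr fun τ hτ => ?_
    have h0 := hε τ (huIcc ▸ hτ)
    simp only [hG, map_sub, map_smul, smul_eq_mul]
    field_simp
    ring
  refine (key.congr_of_eventuallyEq hSG).congr_deriv ?_
  -- the boundary terms come from the fundamental theorem of calculus
  have cB : ContinuousOn (fun τ => π' τ (δαQ τ) + π τ (δαQ' τ) +
      (e' τ * δαT τ + (L (αQ τ) (ν τ) - π τ (ν τ)) * δαT' τ)) (uIcc a b) := by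
    rw [huIcc]
    exact ((hπ'.clm_apply cδαQ).add (cπ.clm_apply hδαQ')).add
      ((ce'.mul cδαT).add (he_C1.continuousOn.mul hδαT'))
  have hB : ∀ τ ∈ Icc a b, HasDerivWithinAt
      (fun τ => π τ (δαQ τ) + (L (αQ τ) (ν τ) - π τ (ν τ)) * δαT τ)
      (π' τ (δαQ τ) + π τ (δαQ' τ) +
        (e' τ * δαT τ + (L (αQ τ) (ν τ) - π τ (ν τ)) * δαT' τ)) (Icc a b) τ := fun τ hτ =>
    ((hπ τ hτ).clm_apply (hδαQ τ hτ)).add ((he' τ hτ).mul (hδαT τ hτ))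
  have hFTC := intervalIntegral.integral_eq_sub_of_hasDerivAt_of_le hab.le
    (fun τ hτ => (hB τ hτ).continuousWithinAt)
    (fun τ hτ => (hB τ (Ioo_subset_Icc_self hτ)).hasDerivAt (Icc_mem_nhds hτ.1 hτ.2))
    cB.intervalIntegrable
  rw [add_sub_assoc, ← hFTC, ← sub_eq_iff_eq_add,
    ← intervalIntegral.integral_sub _ cB.intervalIntegrable]
  · refine intervalIntegral.integral_congr fun τ _ => ?_
    simp only [hG', zero_smul, zero_mul, add_zero, hfd, map_sub, map_smul, smul_eq_mul,
      sub_apply, smul_apply]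
    ring
  · refine ContinuousOn.intervalIntegrable ?_
    exact hG'cont.comp (f := fun τ => ((0 : ℝ), τ)) (by fun_prop)
      fun τ hτ => ⟨mem_univ _, huIcc ▸ hτ⟩
end

section
/- First variation formula (Hamiltonian side, single smooth interval). Define, for ε in a neighborhood of 0 small enough that α_T' + ε·δα_T' > 0 on [a, b], S(ε) = ∫_a^b [(π + ε·δπ)·((α_Q' + ε·δα_Q')/(α_T' + ε·δα_T')) − H(α_Q + ε·δα_Q, π + ε·δπ)]·(α_T' + ε·δα_T') dτ. Then S is differentiable at ε = 0 and S'(0) = ∫_a^b [ (−π' − α_T'·(∂H/∂q)(α_Q, π))·δα_Q + (d/dτ)[H(α_Q, π)]·δα_T + δπ·(α_Q' − α_T'·(∂H/∂p)(α_Q, π)) ] dτ + [π·δα_Q − H(α_Q, π)·δα_T]_{τ=a}^{τ=b}, where [F]_{τ=a}^{τ=b} = F(b) − F(a). -/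
open Set MeasureTheory Metric Topology

/-- Differentiation under the integral sign over a compact interval, for an integrand whose
derivative in the parameter is jointly continuous. -/
theorem hasDerivAt_intervalIntegral_of_continuousOn_deriv
    {E : Type*} [NormedAddCommGroup E] [NormedSpace ℝ E]
    {F F' : ℝ → ℝ → E} {x₀ r a b : ℝ} (hr : 0 < r) (hab : a ≤ b)
    (hF : ∀ x ∈ closedBall x₀ r, ContinuousOn (F x) (Icc a b))
    (hF' : ContinuousOn (fun z : ℝ × ℝ => F' z.1 z.2) (closedBall x₀ r ×ˢ Icc a b))
    (hd : ∀ x ∈ closedBall x₀ r, ∀ t ∈ Icc a b, HasDerivAt (fun y => F y t) (F' x t) x) :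
    HasDerivAt (fun x => ∫ t in a..b, F x t) (∫ t in a..b, F' x₀ t) x₀ := by
  have hsub : uIoc a b ⊆ Icc a b := by
    rw [uIoc_of_le hab]
    exact Ioc_subset_Icc_self
  obtain ⟨C, hC⟩ :=
    ((isCompact_closedBall x₀ r).prod (isCompact_Icc (a := a) (b := b))).exists_bound_of_continuousOn
      hF'
  have hball : closedBall x₀ r ∈ 𝓝 x₀ := closedBall_mem_nhds x₀ hr
  have hx₀ : x₀ ∈ closedBall x₀ r := mem_closedBall_self hr.le
  have hF'₀ : ContinuousOn (F' x₀) (Icc a b) :=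
    hF'.comp (f := fun t => (x₀, t)) (by fun_prop) fun t ht => ⟨hx₀, ht⟩
  have hmeas : ∀ {f : ℝ → E}, ContinuousOn f (Icc a b) →
      AEStronglyMeasurable f (volume.restrict (uIoc a b)) := fun hf =>
    (hf.aestronglyMeasurable measurableSet_Icc).mono_measure (Measure.restrict_mono hsub le_rfl)
  refine (intervalIntegral.hasDerivAt_integral_of_dominated_loc_of_deriv_le
    (bound := fun _ => C) hball ?_ ?_ (hmeas hF'₀) ?_ intervalIntegrable_const ?_).2
  · filter_upwards [hball] with x hx using hmeas (hF x hx)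
  · exact (hF x₀ hx₀).intervalIntegrable_of_Icc hab
  · exact Filter.Eventually.of_forall fun t ht x hx => hC (x, t) ⟨hx, hsub ht⟩
  · exact Filter.Eventually.of_forall fun t ht x hx => hd x hx t (hsub ht)

/-- A function positive on a compact set stays positive under small multiples of a perturbation. -/
theorem IsCompact.eventually_forall_add_mul_pos {X : Type*} [TopologicalSpace X] {K : Set X}
    (hK : IsCompact K) {f g : X → ℝ} (hf : ContinuousOn f K) (hg : ContinuousOn g K)
    (hpos : ∀ x ∈ K, 0 < f x) :
    ∀ᶠ ε : ℝ in 𝓝 0, ∀ x ∈ K, 0 < f x + ε * g x := by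
  rcases K.eq_empty_or_nonempty with rfl | hne
  · simp
  obtain ⟨x₀, hx₀, hmin⟩ := hK.exists_isMinOn hne hf
  obtain ⟨C, hC⟩ := hK.exists_bound_of_continuousOn hg
  have hlim : Filter.Tendsto (fun ε : ℝ => |ε| * C) (𝓝 0) (𝓝 0) := by
    have : Continuous fun ε : ℝ => |ε| * C := by fun_prop
    simpa using this.tendsto 0
  filter_upwards [hlim.eventually_lt_const (hpos x₀ hx₀)] with ε hε x hx
  have h₁ : |ε * g x| ≤ |ε| * C := by
    rw [abs_mul]
    exact mul_le_mul_of_nonneg_left (hC x hx) (abs_nonneg ε)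
  have h₂ : f x₀ ≤ f x := hmin hx
  linarith [neg_abs_le (ε * g x)]

/-- The derivative of a function on a product is the sum of its partial derivatives. -/
theorem HasFDerivAt.apply_prod_eq_add {E F G : Type*} [NormedAddCommGroup E] [NormedSpace ℝ E]
    [NormedAddCommGroup F] [NormedSpace ℝ F] [NormedAddCommGroup G] [NormedSpace ℝ G]
    {f : E × F → G} {D : E × F →L[ℝ] G} {A : E →L[ℝ] G} {B : F →L[ℝ] G} {x : E} {y : F}
    (hf : HasFDerivAt f D (x, y)) (hA : HasFDerivAt (fun x' => f (x', y)) A x)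
    (hB : HasFDerivAt (fun y' => f (x, y')) B y) (u : E) (v : F) :
    D (u, v) = A u + B v := by
  have h₁ := hA.unique (hf.comp x (hasFDerivAt_prodMk_left x y))
  have h₂ := hB.unique (hf.comp y (hasFDerivAt_prodMk_right x y))
  rw [h₁, h₂]
  simp [← map_add]

/-- **First variation formula (Hamiltonian side, single smooth interval).**
`V` is a finite-dimensional real normed vector space and `H : V × V* → ℝ` a `C¹`
Hamiltonian with partial derivatives `Hq = ∂H/∂q ∈ V*` and `Hp = ∂H/∂p`, the latter
identified with an element of `V` via `V ≅ V**` (so that the derivative of `p ↦ H(q, p)`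
is the evaluation functional `ζ ↦ ζ (Hp q p)`).  On `[a, b]`, the curves `αT` (with
`αT' > 0`), `αQ`, `π` and the variations `δαT`, `δαQ`, `δπ` are `C¹` (with the indicated
derivatives), and `h'` is the derivative of `τ ↦ H(αQ(τ), π(τ))`.  Then the action
`S(ε) = ∫_a^b [(π + ε δπ)·((αQ' + ε δαQ')/(αT' + ε δαT'))
        − H(αQ + ε δαQ, π + ε δπ)]·(αT' + ε δαT') dτ`
is differentiable at `ε = 0` with
`S'(0) = ∫_a^b [(−π' − αT'·∂H/∂q)·δαQ + (d/dτ)[H(αQ, π)]·δαT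
        + δπ·(αQ' − αT'·∂H/∂p)] dτ + [π·δαQ − H(αQ, π)·δαT]_{τ=a}^{τ=b}`. -/
theorem first_variation_hamiltonian
    {V : Type*} [NormedAddCommGroup V] [NormedSpace ℝ V] [FiniteDimensional ℝ V]
    (H : V → (V →L[ℝ] ℝ) → ℝ)
    (Hq : V → (V →L[ℝ] ℝ) → (V →L[ℝ] ℝ)) (Hp : V → (V →L[ℝ] ℝ) → V)
    (hHC1 : ContDiff ℝ 1 fun qp : V × (V →L[ℝ] ℝ) => H qp.1 qp.2)
    (hHq : ∀ q p, HasFDerivAt (fun q' => H q' p) (Hq q p) q)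
    (hHp : ∀ q p, HasFDerivAt (fun p' : V →L[ℝ] ℝ => H q p')
      (ContinuousLinearMap.apply ℝ ℝ (Hp q p)) p)
    (a b : ℝ) (hab : a < b)
    (αT αT' δαT δαT' : ℝ → ℝ) (αQ αQ' δαQ δαQ' : ℝ → V)
    (π π' δπ : ℝ → (V →L[ℝ] ℝ)) (h' : ℝ → ℝ)
    -- the curves and the variations are C¹ on [a, b]
    (hαT : ∀ τ ∈ Icc a b, HasDerivWithinAt αT (αT' τ) (Icc a b) τ)
    (hαT' : ContinuousOn αT' (Icc a b))
    (hαTpos : ∀ τ ∈ Icc a b, 0 < αT' τ)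
    (hαQ : ∀ τ ∈ Icc a b, HasDerivWithinAt αQ (αQ' τ) (Icc a b) τ)
    (hαQ' : ContinuousOn αQ' (Icc a b))
    (hπ : ∀ τ ∈ Icc a b, HasDerivWithinAt π (π' τ) (Icc a b) τ)
    (hπ' : ContinuousOn π' (Icc a b))
    (hδαT : ∀ τ ∈ Icc a b, HasDerivWithinAt δαT (δαT' τ) (Icc a b) τ)
    (hδαT' : ContinuousOn δαT' (Icc a b))
    (hδαQ : ∀ τ ∈ Icc a b, HasDerivWithinAt δαQ (δαQ' τ) (Icc a b) τ)
    (hδαQ' : ContinuousOn δαQ' (Icc a b))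
    (hδπ : ContDiffOn ℝ 1 δπ (Icc a b))
    -- h' is the derivative of τ ↦ H(αQ(τ), π(τ))
    (hh' : ∀ τ ∈ Icc a b,
      HasDerivWithinAt (fun σ => H (αQ σ) (π σ)) (h' τ) (Icc a b) τ) :
    HasDerivAt (fun ε : ℝ => ∫ τ in a..b,
        ((π τ + ε • δπ τ) ((αT' τ + ε * δαT' τ)⁻¹ • (αQ' τ + ε • δαQ' τ)) -
          H (αQ τ + ε • δαQ τ) (π τ + ε • δπ τ)) *
        (αT' τ + ε * δαT' τ))
      ((∫ τ in a..b,
          (-π' τ - αT' τ • Hq (αQ τ) (π τ)) (δαQ τ) + h' τ * δαT τ +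
            δπ τ (αQ' τ - αT' τ • Hp (αQ τ) (π τ))) +
        (π b (δαQ b) - H (αQ b) (π b) * δαT b) -
        (π a (δαQ a) - H (αQ a) (π a) * δαT a))
      0 := by
  set Hu : V × (V →L[ℝ] ℝ) → ℝ := fun qp => H qp.1 qp.2 with hHu
  have hD : ∀ x, HasFDerivAt Hu (fderiv ℝ Hu x) x := fun x =>
    (hHC1.differentiable one_ne_zero x).hasFDerivAt
  have hDcont : Continuous (fderiv ℝ Hu) := hHC1.continuous_fderiv one_ne_zero
  have hHcont : Continuous Hu := hHC1.continuous
  have hDapply : ∀ q p u ζ, fderiv ℝ Hu (q, p) (u, ζ) = Hq q p u + ζ (Hp q p) := fun q p u ζ => by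
    simpa using (hD (q, p)).apply_prod_eq_add (hHq q p) (hHp q p) u ζ
  have cαQ : ContinuousOn αQ (Icc a b) := fun τ hτ => (hαQ τ hτ).continuousWithinAt
  have cπ : ContinuousOn π (Icc a b) := fun τ hτ => (hπ τ hτ).continuousWithinAt
  have cδαT : ContinuousOn δαT (Icc a b) := fun τ hτ => (hδαT τ hτ).continuousWithinAt
  have cδαQ : ContinuousOn δαQ (Icc a b) := fun τ hτ => (hδαQ τ hτ).continuousWithinAt
  have cδπ : ContinuousOn δπ (Icc a b) := hδπ.continuousOn
  have ch : ContinuousOn (fun τ => H (αQ τ) (π τ)) (Icc a b) := fun τ hτ =>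
    (hh' τ hτ).continuousWithinAt
  have ch' : ContinuousOn h' (Icc a b) := by
    have : ContinuousOn (fun τ => fderiv ℝ Hu (αQ τ, π τ) (αQ' τ, π' τ)) (Icc a b) :=
      (hDcont.comp_continuousOn (cαQ.prodMk cπ)).clm_apply (hαQ'.prodMk hπ')
    refine this.congr fun τ hτ => ?_
    exact (uniqueDiffOn_Icc hab τ hτ).eq_deriv _ (hh' τ hτ)
      ((hD _).comp_hasDerivWithinAt τ ((hαQ τ hτ).prodMk (hπ τ hτ)))
  -- the integrand of the action with the denominator cleared, and its derivative in `ε`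
  let G : ℝ → ℝ → ℝ := fun ε τ =>
    (π τ + ε • δπ τ) (αQ' τ + ε • δαQ' τ) -
      Hu (αQ τ + ε • δαQ τ, π τ + ε • δπ τ) * (αT' τ + ε * δαT' τ)
  let G' : ℝ → ℝ → ℝ := fun ε τ =>
    δπ τ (αQ' τ + ε • δαQ' τ) + (π τ + ε • δπ τ) (δαQ' τ) -
      (fderiv ℝ Hu (αQ τ + ε • δαQ τ, π τ + ε • δπ τ) (δαQ τ, δπ τ) * (αT' τ + ε * δαT' τ) +
        Hu (αQ τ + ε • δαQ τ, π τ + ε • δπ τ) * δαT' τ)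
  have hG : ∀ ε, ContinuousOn (G ε) (Icc a b) := fun ε =>
    ((cπ.add (cδπ.const_smul ε)).clm_apply (hαQ'.add (hδαQ'.const_smul ε))).sub
      ((hHcont.comp_continuousOn
        ((cαQ.add (cδαQ.const_smul ε)).prodMk (cπ.add (cδπ.const_smul ε)))).mul
        (hαT'.add (continuousOn_const.mul hδαT')))
  have hG' : ContinuousOn (fun z : ℝ × ℝ => G' z.1 z.2) (univ ×ˢ Icc a b) := by
    have hs : MapsTo Prod.snd ((univ : Set ℝ) ×ˢ Icc a b) (Icc a b) := fun z hz => hz.2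
    have c₁ := cαQ.comp continuousOn_snd hs
    have c₂ := cπ.comp continuousOn_snd hs
    have c₃ := cδαQ.comp continuousOn_snd hs
    have c₄ := cδπ.comp continuousOn_snd hs
    have c₅ := hαQ'.comp continuousOn_snd hs
    have c₆ := hδαQ'.comp continuousOn_snd hs
    have c₇ := hαT'.comp continuousOn_snd hs
    have c₈ := hδαT'.comp continuousOn_snd hs
    have c₀ : ContinuousOn (Prod.fst : ℝ × ℝ → ℝ) (univ ×ˢ Icc a b) := continuousOn_fst
    have cx := (c₁.add (c₀.smul c₃)).prodMk (c₂.add (c₀.smul c₄))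
    exact ((c₄.clm_apply (c₅.add (c₀.smul c₆))).add ((c₂.add (c₀.smul c₄)).clm_apply c₆)).sub
      ((((hDcont.comp_continuousOn cx).clm_apply (c₃.prodMk c₄)).mul (c₇.add (c₀.mul c₈))).add
        ((hHcont.comp_continuousOn cx).mul c₈))
  have hderiv : ∀ ε τ, HasDerivAt (fun y => G y τ) (G' ε τ) ε := by
    intro ε τ
    have lineT : HasDerivAt (fun y : ℝ => αT' τ + y * δαT' τ) (δαT' τ) ε := by
      simpa using ((hasDerivAt_id ε).mul_const (δαT' τ)).const_add (αT' τ)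
    have lineQ := (hasDerivAt_id ε).smul_const (δαQ τ) |>.const_add (αQ τ)
    have lineQ' := (hasDerivAt_id ε).smul_const (δαQ' τ) |>.const_add (αQ' τ)
    have lineπ := (hasDerivAt_id ε).smul_const (δπ τ) |>.const_add (π τ)
    simp only [one_smul, id] at lineQ lineQ' lineπ
    exact (lineπ.clm_apply lineQ').sub
      (((hD _).comp_hasDerivAt ε (lineQ.prodMk lineπ)).mul lineT)
  have hmain : HasDerivAt (fun ε => ∫ τ in a..b, G ε τ) (∫ τ in a..b, G' 0 τ) 0 :=
    hasDerivAt_intervalIntegral_of_continuousOn_deriv one_pos hab.le (fun ε _ => hG ε)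
      (hG'.mono (prod_mono (subset_univ _) Subset.rfl)) fun ε _ τ _ => hderiv ε τ
  have hG'₀ : ContinuousOn (G' 0) (Icc a b) :=
    hG'.comp (f := fun t => ((0 : ℝ), t)) (by fun_prop) fun t ht => ⟨mem_univ _, ht⟩
  -- the boundary term and its derivative in `τ`
  let B : ℝ → ℝ := fun τ => π τ (δαQ τ) - H (αQ τ) (π τ) * δαT τ
  let B' : ℝ → ℝ := fun τ =>
    π' τ (δαQ τ) + π τ (δαQ' τ) - (h' τ * δαT τ + H (αQ τ) (π τ) * δαT' τ)
  have hB : ∀ τ ∈ Icc a b, HasDerivWithinAt B (B' τ) (Icc a b) τ := fun τ hτ =>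
    ((hπ τ hτ).clm_apply (hδαQ τ hτ)).sub ((hh' τ hτ).mul (hδαT τ hτ))
  have hB' : ContinuousOn B' (Icc a b) :=
    ((hπ'.clm_apply cδαQ).add (cπ.clm_apply hδαQ')).sub ((ch'.mul cδαT).add (ch.mul hδαT'))
  have hFTC : ∫ τ in a..b, B' τ = B b - B a :=
    intervalIntegral.integral_eq_sub_of_hasDerivAt_of_le hab.le
      (fun τ hτ => (hB τ hτ).continuousWithinAt)
      (fun τ hτ => (hB τ (Ioo_subset_Icc_self hτ)).hasDerivAt (Icc_mem_nhds hτ.1 hτ.2))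
      (hB'.intervalIntegrable_of_Icc hab.le)
  have hint : (∫ τ in a..b,
      (-π' τ - αT' τ • Hq (αQ τ) (π τ)) (δαQ τ) + h' τ * δαT τ +
        δπ τ (αQ' τ - αT' τ • Hp (αQ τ) (π τ))) =
      (∫ τ in a..b, G' 0 τ) - ∫ τ in a..b, B' τ := by
    rw [← intervalIntegral.integral_sub (hG'₀.intervalIntegrable_of_Icc hab.le)
      (hB'.intervalIntegrable_of_Icc hab.le)]
    congr 1
    funext τ
    simp only [G', B', hHu, zero_smul, add_zero, zero_mul, sub_apply, neg_apply, smul_apply,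
      map_sub, map_smul, smul_eq_mul]
    rw [← hHu, hDapply]
    ring
  rw [hint, hFTC]
  have hval : (∫ τ in a..b, G' 0 τ) - (B b - B a) + (π b (δαQ b) - H (αQ b) (π b) * δαT b) -
      (π a (δαQ a) - H (αQ a) (π a) * δαT a) = ∫ τ in a..b, G' 0 τ := by
    simp only [B]
    ring
  rw [hval]
  refine hmain.congr_of_eventuallyEq ?_
  filter_upwards [isCompact_Icc.eventually_forall_add_mul_pos hαT' hδαT' hαTpos] with ε hε
  refine intervalIntegral.integral_congr fun τ hτ => ?_
  rw [uIcc_of_le hab.le] at hτ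
  have hne := (hε τ hτ).ne'
  simp only [G, hHu, map_smul, smul_eq_mul]
  field_simp
end

section
/- Energy balance for the implicit Lagrange–d'Alembert equations. Let I ⊆ ℝ be an open interval and let q, v : I → V and p : I → V* be differentiable curves such that for every t ∈ I: q̇(t) = v(t) ∈ Δ(q(t)); p(t) = (∂L/∂v)(q(t), v(t)); and ṗ(t) − (∂L/∂q)(q(t), v(t)) ∈ Δ(q(t))°. Then the energy E(t) = p(t)·v(t) − L(q(t), v(t)) has derivative zero at every t ∈ I; in particular E is constant on I. -/
open Set

/-- The annihilator of a subspace `U ⊆ V`, inside the topological dual of `V`: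
the set of continuous linear functionals vanishing on `U`. -/
def ann {V : Type*} [NormedAddCommGroup V] [NormedSpace ℝ V]
    (U : Submodule ℝ V) : Set (V →L[ℝ] ℝ) :=
  {ζ | ∀ u ∈ U, ζ u = 0}

/-- The Fréchet derivative of a differentiable function of two variables is the sum of its
partial derivatives. -/
theorem HasFDerivAt.of_differentiableAt_of_partial
    {𝕜 E F G : Type*} [NontriviallyNormedField 𝕜]
    [NormedAddCommGroup E] [NormedSpace 𝕜 E] [NormedAddCommGroup F] [NormedSpace 𝕜 F]
    [NormedAddCommGroup G] [NormedSpace 𝕜 G] {f : E → F → G} {x : E} {y : F}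
    {f₁ : E →L[𝕜] G} {f₂ : F →L[𝕜] G}
    (hf : DifferentiableAt 𝕜 (fun z : E × F => f z.1 z.2) (x, y))
    (h₁ : HasFDerivAt (fun x' => f x' y) f₁ x) (h₂ : HasFDerivAt (fun y' => f x y') f₂ y) :
    HasFDerivAt (fun z : E × F => f z.1 z.2) (f₁.coprod f₂) (x, y) := by
  have hD := hf.hasFDerivAt
  have e₁ := h₁.unique (HasFDerivAt.comp (f := fun x' => (x', y)) x hD
    (hasFDerivAt_prodMk_left x y))
  have e₂ := h₂.unique (HasFDerivAt.comp (f := fun y' => (x, y')) y hD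
    (hasFDerivAt_prodMk_right x y))
  convert hD
  ext w <;> simp [e₁, e₂]

/-- **Energy balance for the implicit Lagrange–d'Alembert equations.**
`V` is a finite-dimensional real normed vector space, `L : V × V → ℝ` a `C¹` Lagrangian
with partial derivatives `Lq = ∂L/∂q` and `Lv = ∂L/∂v`, and `Δ` a constraint distribution.
If differentiable curves `q, v : I → V`, `p : I → V*` on an open interval `I = (a, b)`
satisfy the implicit Lagrange–d'Alembert equations
`q̇ = v ∈ Δ(q)`, `p = ∂L/∂v(q, v)` and `ṗ − ∂L/∂q(q, v) ∈ Δ(q)°`,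
then the energy `E = p·v − L(q, v)` has derivative zero at every `t ∈ I`;
in particular `E` is constant on `I`. -/
theorem energy_balance_implicit_lagrange_dalembert
    {V : Type*} [NormedAddCommGroup V] [NormedSpace ℝ V] [FiniteDimensional ℝ V]
    (L : V → V → ℝ) (Lq Lv : V → V → (V →L[ℝ] ℝ))
    (hLC1 : ContDiff ℝ 1 fun qv : V × V => L qv.1 qv.2)
    (hLq : ∀ q v, HasFDerivAt (fun q' => L q' v) (Lq q v) q)
    (hLv : ∀ q v, HasFDerivAt (fun v' => L q v') (Lv q v) v)
    (Δ : V → Submodule ℝ V)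
    (a b : ℝ) (q v : ℝ → V) (p : ℝ → (V →L[ℝ] ℝ))
    (q' v' : ℝ → V) (p' : ℝ → (V →L[ℝ] ℝ))
    (hq : ∀ t ∈ Ioo a b, HasDerivAt q (q' t) t)
    (hv : ∀ t ∈ Ioo a b, HasDerivAt v (v' t) t)
    (hp : ∀ t ∈ Ioo a b, HasDerivAt p (p' t) t)
    (heq1 : ∀ t ∈ Ioo a b, q' t = v t)
    (heq2 : ∀ t ∈ Ioo a b, v t ∈ Δ (q t))
    (heq3 : ∀ t ∈ Ioo a b, p t = Lv (q t) (v t))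
    (heq4 : ∀ t ∈ Ioo a b, p' t - Lq (q t) (v t) ∈ ann (Δ (q t))) :
    (∀ t ∈ Ioo a b, HasDerivAt (fun s => p s (v s) - L (q s) (v s)) 0 t) ∧
    ∀ s ∈ Ioo a b, ∀ t ∈ Ioo a b,
      p s (v s) - L (q s) (v s) = p t (v t) - L (q t) (v t) := by
  have hE : ∀ t ∈ Ioo a b, HasDerivAt (fun s => p s (v s) - L (q s) (v s)) 0 t := by
    intro t ht
    have hL := (HasFDerivAt.of_differentiableAt_of_partial
      (hLC1.differentiable one_ne_zero (q t, v t)) (hLq _ _) (hLv _ _)).comp_hasDerivAt t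
      ((hq t ht).prodMk (hv t ht))
    have hann := heq4 t ht (v t) (heq2 t ht)
    rw [sub_apply] at hann
    refine (((hp t ht).clm_apply (hv t ht)).sub hL).congr_deriv ?_
    rw [ContinuousLinearMap.coprod_apply, heq1 t ht, heq3 t ht]
    linarith
  refine ⟨hE, fun s hs t ht => ?_⟩
  exact isOpen_Ioo.is_const_of_deriv_eq_zero isPreconnected_Ioo
    (fun x hx => (hE x hx).differentiableAt.differentiableWithinAt)
    (fun x hx => (hE x hx).deriv) hs ht
end

section
/- Derivatives of the Hamiltonian induced by a hyperregular Lagrangian. Assume the Legendre transform 𝔽L : V × V → V × V*, (q, v) ↦ (q, (∂L/∂v)(q, v)), is a bijection whose inverse is differentiable, and define H : V × V* → ℝ by H(q, p) = p·v − L(q, v), where v is the unique element of V with (∂L/∂v)(q, v) = p. Then H is differentiable and for every (q, v) ∈ V × V: (∂H/∂p)(q, (∂L/∂v)(q, v)) = v and (∂H/∂q)(q, (∂L/∂v)(q, v)) = −(∂L/∂q)(q, v). -/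
/-- The total derivative of a `C¹` function on a product, expressed by its partial derivatives. -/
theorem ContDiff.hasFDerivAt_coprod_partials {V W : Type*} [NormedAddCommGroup V] [NormedSpace ℝ V]
    [NormedAddCommGroup W] [NormedSpace ℝ W] {L : V → W → ℝ} {q : V} {v : W}
    {a : V →L[ℝ] ℝ} {b : W →L[ℝ] ℝ} (hL : ContDiff ℝ 1 fun x : V × W => L x.1 x.2)
    (ha : HasFDerivAt (fun q' => L q' v) a q) (hb : HasFDerivAt (fun v' => L q v') b v) :
    HasFDerivAt (fun x : V × W => L x.1 x.2) (a.coprod b) (q, v) := by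
  have h := (hL.differentiable one_ne_zero (q, v)).hasFDerivAt
  have h₁ := ha.unique (h.comp (f := fun q' => (q', v)) q (hasFDerivAt_prodMk_left q v))
  have h₂ := hb.unique (h.comp v (hasFDerivAt_prodMk_right q v))
  refine h.congr_fderiv ?_
  rw [h₁, h₂]
  ext x <;> simp

/-- **Derivatives of the Hamiltonian induced by a hyperregular Lagrangian.**
`V` is a finite-dimensional real normed vector space and `L : V × V → ℝ` a `C¹`
Lagrangian with partial derivatives `Lq = ∂L/∂q` and `Lv = ∂L/∂v`.  Assume the Legendre
transform `𝔽L (q, v) = (q, ∂L/∂v(q, v))` is a bijection with a differentiable inverse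
`G`, and that `H : V × V* → ℝ` satisfies `H(q, 𝔽L(q,v).2) = 𝔽L(q,v).2 · v − L(q, v)`
(which determines `H` since `𝔽L` is surjective).  Then `H` is differentiable and, for
every `(q, v)`: the partial derivative of `H` in `p` at `(q, ∂L/∂v(q,v))` is the
evaluation functional of `v` (i.e. `∂H/∂p = v` under `V ≅ V**`), and the partial
derivative of `H` in `q` at `(q, ∂L/∂v(q,v))` is `−∂L/∂q(q, v)`. -/
theorem legendre_transform_hamiltonian_derivatives
    {V : Type*} [NormedAddCommGroup V] [NormedSpace ℝ V] [FiniteDimensional ℝ V]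
    (L : V → V → ℝ) (Lq Lv : V → V → (V →L[ℝ] ℝ))
    (hLC1 : ContDiff ℝ 1 fun qv : V × V => L qv.1 qv.2)
    (hLq : ∀ q v, HasFDerivAt (fun q' => L q' v) (Lq q v) q)
    (hLv : ∀ q v, HasFDerivAt (fun v' => L q v') (Lv q v) v)
    (hbij : Function.Bijective fun qv : V × V => (qv.1, Lv qv.1 qv.2))
    (G : V × (V →L[ℝ] ℝ) → V × V)
    (hGleft : Function.LeftInverse G fun qv : V × V => (qv.1, Lv qv.1 qv.2))
    (hGright : Function.RightInverse G fun qv : V × V => (qv.1, Lv qv.1 qv.2))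
    (hGdiff : Differentiable ℝ G)
    (H : V → (V →L[ℝ] ℝ) → ℝ)
    (hH : ∀ q v, H q (Lv q v) = Lv q v v - L q v) :
    Differentiable ℝ (fun qp : V × (V →L[ℝ] ℝ) => H qp.1 qp.2) ∧
    ∀ q v : V,
      HasFDerivAt (fun p : V →L[ℝ] ℝ => H q p)
        (ContinuousLinearMap.apply ℝ ℝ v) (Lv q v) ∧
      HasFDerivAt (fun q' => H q' (Lv q v)) (-(Lq q v)) q := by
  have hfst : ∀ x, (G x).1 = x.1 := fun x => congrArg Prod.fst (hGright x)
  have hsnd : ∀ x, Lv x.1 (G x).2 = x.2 := fun x => by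
    have h := congrArg Prod.snd (hGright x)
    simpa only [hfst] using h
  have hHG : (fun x : V × (V →L[ℝ] ℝ) => H x.1 x.2) =
      fun x => x.2 (G x).2 - L x.1 (G x).2 := by
    funext x
    simpa only [hsnd] using hH x.1 (G x).2
  have key : ∀ q v, HasFDerivAt (fun x : V × (V →L[ℝ] ℝ) => H x.1 x.2)
      ((ContinuousLinearMap.apply ℝ ℝ v).comp (ContinuousLinearMap.snd ℝ V (V →L[ℝ] ℝ)) -
        (Lq q v).comp (ContinuousLinearMap.fst ℝ V (V →L[ℝ] ℝ))) (q, Lv q v) := by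
    intro q v
    rw [hHG]
    have hG : G (q, Lv q v) = (q, v) := hGleft (q, v)
    have hL := hLC1.hasFDerivAt_coprod_partials (hLq q v) (hLv q v)
    have hw := (hGdiff (q, Lv q v)).hasFDerivAt.snd
    have hpair := (hasFDerivAt_fst (𝕜 := ℝ) (p := (q, Lv q v))).prodMk hw
    have hLw := HasFDerivAt.comp (q, Lv q v)
      (g := fun qv : V × V => L qv.1 qv.2) (by simpa only [hG] using hL) hpair
    refine ((hasFDerivAt_snd.clm_apply hw).sub hLw).congr_fderiv ?_
    ext x <;> simp [hG]
  refine ⟨fun x => ?_, fun q v => ⟨?_, ?_⟩⟩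
  · simpa only [hsnd] using (key x.1 (G x).2).differentiableAt
  · refine ((key q v).comp (Lv q v) (hasFDerivAt_prodMk_right q (Lv q v))).congr_fderiv ?_
    ext p
    simp
  · refine ((key q v).comp (f := fun u => (u, Lv q v)) q
      (hasFDerivAt_prodMk_left q (Lv q v))).congr_fderiv ?_
    ext u
    simp
end

section
/- Equivalence of the implicit Lagrangian and Hamiltonian formalisms for hyperregular Lagrangians. Assume the Legendre transform 𝔽L : V × V → V × V*, (q, v) ↦ (q, (∂L/∂v)(q, v)), is a bijection whose inverse is differentiable, and define H : V × V* → ℝ by H(q, p) = p·v − L(q, v), where v is the unique element of V with (∂L/∂v)(q, v) = p. Let I ⊆ ℝ be an open interval and let q, v : I → V and p : I → V* be curves with q and p differentiable and p(t) = (∂L/∂v)(q(t), v(t)) for all t ∈ I. Then the implicit Euler–Lagrange equations hold on I, namely q̇(t) = v(t) ∈ Δ(q(t)) and ṗ(t) − (∂L/∂q)(q(t), v(t)) ∈ Δ(q(t))° for all t, if and only if the implicit Hamilton equations hold on I, namely q̇(t) = (∂H/∂p)(q(t), p(t)) ∈ Δ(q(t)) and ṗ(t) + (∂H/∂q)(q(t),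 p(t)) ∈ Δ(q(t))° for all t. Moreover, in either case p(t)·v(t) − L(q(t), v(t)) = H(q(t), p(t)) for all t ∈ I. -/
open Set

/-- Restricting a differentiable function on a product to a horizontal slice. -/
theorem HasFDerivAt.slice_left {E F G : Type*}
    [NormedAddCommGroup E] [NormedSpace ℝ E] [NormedAddCommGroup F] [NormedSpace ℝ F]
    [NormedAddCommGroup G] [NormedSpace ℝ G] {f : E → F → G} {x : E} {y : F}
    {f' : E × F →L[ℝ] G} (hf : HasFDerivAt (fun z : E × F => f z.1 z.2) f' (x, y)) :
    HasFDerivAt (fun x' => f x' y) (f' ∘L ContinuousLinearMap.inl ℝ E F) x :=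
  HasFDerivAt.comp (g := fun z : E × F => f z.1 z.2) (f := fun x' => (x', y)) x hf
    (hasFDerivAt_prodMk_left x y)

/-- Restricting a differentiable function on a product to a vertical slice. -/
theorem HasFDerivAt.slice_right {E F G : Type*}
    [NormedAddCommGroup E] [NormedSpace ℝ E] [NormedAddCommGroup F] [NormedSpace ℝ F]
    [NormedAddCommGroup G] [NormedSpace ℝ G] {f : E → F → G} {x : E} {y : F}
    {f' : E × F →L[ℝ] G} (hf : HasFDerivAt (fun z : E × F => f z.1 z.2) f' (x, y)) :
    HasFDerivAt (fun y' => f x y') (f' ∘L ContinuousLinearMap.inr ℝ E F) y :=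
  HasFDerivAt.comp (g := fun z : E × F => f z.1 z.2) (f := fun y' => (x, y')) y hf
    (hasFDerivAt_prodMk_right x y)

/-- The differential of a function on a product is determined by its partial differentials. -/
theorem HasFDerivAt.coprod_of_partial {E F G : Type*}
    [NormedAddCommGroup E] [NormedSpace ℝ E] [NormedAddCommGroup F] [NormedSpace ℝ F]
    [NormedAddCommGroup G] [NormedSpace ℝ G] {f : E → F → G} {x : E} {y : F}
    {fx : E →L[ℝ] G} {fy : F →L[ℝ] G}
    (hf : DifferentiableAt ℝ (fun z : E × F => f z.1 z.2) (x, y))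
    (hx : HasFDerivAt (fun x' => f x' y) fx x) (hy : HasFDerivAt (fun y' => f x y') fy y) :
    HasFDerivAt (fun z : E × F => f z.1 z.2) (fx.coprod fy) (x, y) := by
  have hfx := hx.unique hf.hasFDerivAt.slice_left
  have hfy := hy.unique hf.hasFDerivAt.slice_right
  convert hf.hasFDerivAt using 1
  rw [hfx, hfy]
  ext z <;> simp

/-- The differential of the energy `p · w - L (q, w)` along a differentiable fibre coordinate
`w = w (q, p)` does not involve the differential of `w` at a point where `p = ∂L/∂v`. -/
theorem hasFDerivAt_legendre_energy {V : Type*} [NormedAddCommGroup V] [NormedSpace ℝ V]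
    {L : V → V → ℝ} {w : V × (V →L[ℝ] ℝ) → V} {q v : V} {Lq Lv : V →L[ℝ] ℝ}
    (hL : DifferentiableAt ℝ (fun z : V × V => L z.1 z.2) (q, v))
    (hLq : HasFDerivAt (fun q' => L q' v) Lq q) (hLv : HasFDerivAt (fun v' => L q v') Lv v)
    (hw : DifferentiableAt ℝ w (q, Lv)) (hwv : w (q, Lv) = v) :
    HasFDerivAt (fun z : V × (V →L[ℝ] ℝ) => z.2 (w z) - L z.1 (w z))
      ((-Lq).coprod (ContinuousLinearMap.apply ℝ ℝ v)) (q, Lv) := by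
  subst hwv
  have hpw := (hasFDerivAt_snd (𝕜 := ℝ) (p := (q, Lv))).clm_apply hw.hasFDerivAt
  have hLw := (HasFDerivAt.coprod_of_partial hL hLq hLv).comp (q, Lv)
    ((hasFDerivAt_fst (𝕜 := ℝ) (p := (q, Lv))).prodMk hw.hasFDerivAt)
  refine (hpw.sub hLw).congr_fderiv ?_
  ext z <;> simp

/-- **Equivalence of the implicit Lagrangian and Hamiltonian formalisms for hyperregular
Lagrangians.**  `V` is a finite-dimensional real normed vector space, `L : V × V → ℝ` a
`C¹` Lagrangian with partial derivatives `Lq = ∂L/∂q`, `Lv = ∂L/∂v`, and `Δ` a constraint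
distribution.  Assume the Legendre transform `𝔽L (q, v) = (q, ∂L/∂v(q, v))` is a
bijection with a differentiable inverse `G`, and that `H : V × V* → ℝ` satisfies
`H(q, ∂L/∂v(q,v)) = ∂L/∂v(q,v) · v − L(q, v)`; let `Hq = ∂H/∂q` and `Hp = ∂H/∂p` (the
latter identified with an element of `V` via `V ≅ V**`).  Let `q, v : I → V`, `p : I → V*`
be curves on the open interval `I = (a, b)` with `q, p` differentiable and
`p = ∂L/∂v(q, v)`.  Then the implicit Euler–Lagrange equations
(`q̇ = v ∈ Δ(q)` and `ṗ − ∂L/∂q(q, v) ∈ Δ(q)°`) hold on `I` if and only if the implicit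
Hamilton equations (`q̇ = ∂H/∂p(q, p) ∈ Δ(q)` and `ṗ + ∂H/∂q(q, p) ∈ Δ(q)°`) hold on
`I`; moreover `p·v − L(q, v) = H(q, p)` on `I`. -/
theorem implicit_lagrangian_hamiltonian_equivalence
    {V : Type*} [NormedAddCommGroup V] [NormedSpace ℝ V] [FiniteDimensional ℝ V]
    (L : V → V → ℝ) (Lq Lv : V → V → (V →L[ℝ] ℝ))
    (hLC1 : ContDiff ℝ 1 fun qv : V × V => L qv.1 qv.2)
    (hLq : ∀ q v, HasFDerivAt (fun q' => L q' v) (Lq q v) q)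
    (hLv : ∀ q v, HasFDerivAt (fun v' => L q v') (Lv q v) v)
    (Δ : V → Submodule ℝ V)
    (hbij : Function.Bijective fun qv : V × V => (qv.1, Lv qv.1 qv.2))
    (G : V × (V →L[ℝ] ℝ) → V × V)
    (hGleft : Function.LeftInverse G fun qv : V × V => (qv.1, Lv qv.1 qv.2))
    (hGright : Function.RightInverse G fun qv : V × V => (qv.1, Lv qv.1 qv.2))
    (hGdiff : Differentiable ℝ G)
    (H : V → (V →L[ℝ] ℝ) → ℝ)
    (hH : ∀ q v, H q (Lv q v) = Lv q v v - L q v)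
    (Hq : V → (V →L[ℝ] ℝ) → (V →L[ℝ] ℝ)) (Hp : V → (V →L[ℝ] ℝ) → V)
    (hHq : ∀ qq pp, HasFDerivAt (fun q' => H q' pp) (Hq qq pp) qq)
    (hHp : ∀ qq pp, HasFDerivAt (fun p' : V →L[ℝ] ℝ => H qq p')
      (ContinuousLinearMap.apply ℝ ℝ (Hp qq pp)) pp)
    (a b : ℝ) (q v : ℝ → V) (p : ℝ → (V →L[ℝ] ℝ))
    (q' : ℝ → V) (p' : ℝ → (V →L[ℝ] ℝ))
    (hq : ∀ t ∈ Ioo a b, HasDerivAt q (q' t) t)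
    (hp : ∀ t ∈ Ioo a b, HasDerivAt p (p' t) t)
    (hLeg : ∀ t ∈ Ioo a b, p t = Lv (q t) (v t)) :
    ((∀ t ∈ Ioo a b, q' t = v t ∧ v t ∈ Δ (q t) ∧
        p' t - Lq (q t) (v t) ∈ ann (Δ (q t))) ↔
      (∀ t ∈ Ioo a b, q' t = Hp (q t) (p t) ∧ q' t ∈ Δ (q t) ∧
        p' t + Hq (q t) (p t) ∈ ann (Δ (q t)))) ∧
    ∀ t ∈ Ioo a b, p t (v t) - L (q t) (v t) = H (q t) (p t) := by
  have hGsnd : ∀ q v, (G (q, Lv q v)).2 = v := fun q v => congrArg Prod.snd (hGleft (q, v))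
  have hHG : ∀ z : V × (V →L[ℝ] ℝ), H z.1 z.2 = z.2 (G z).2 - L z.1 (G z).2 := by
    intro z
    obtain ⟨⟨q, v⟩, rfl⟩ := hbij.surjective z
    simp only [hGsnd, hH]
  have hHd : ∀ q v, HasFDerivAt (fun z : V × (V →L[ℝ] ℝ) => H z.1 z.2)
      ((-Lq q v).coprod (ContinuousLinearMap.apply ℝ ℝ v)) (q, Lv q v) := by
    intro q v
    rw [funext hHG]
    exact hasFDerivAt_legendre_energy (hLC1.differentiable one_ne_zero _) (hLq q v) (hLv q v)
      (hGdiff _).snd (hGsnd q v)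
  have hHq_eq : ∀ q v, Hq q (Lv q v) = -Lq q v := by
    intro q v
    rw [(hHq q (Lv q v)).unique (hHd q v).slice_left]
    ext u
    simp
  have hHp_eq : ∀ q v, Hp q (Lv q v) = v := by
    intro q v
    have h := (hHp q (Lv q v)).unique (hHd q v).slice_right
    refine (SeparatingDual.eq_iff_forall_dual_eq (R := ℝ)).2 fun ζ => ?_
    simpa using DFunLike.congr_fun h ζ
  refine ⟨forall₂_congr fun t ht => ?_, fun t ht => ?_⟩
  · rw [hLeg t ht, hHq_eq, hHp_eq, ← sub_eq_add_neg]
    exact and_congr_right fun h => by rw [h]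
  · rw [hLeg t ht, hH]
end

section
/- Impulse space at the impact for the vertical rolling disk. For every R > 0 and ϕ ∈ ℝ, with Δ_ϕ = span{e_3 + R·cos ϕ·e_1 + R·sin ϕ·e_2, e_4} and W_ϕ = span{e_1, e_3, e_4 − R·cos ϕ·e_2} in ℝ⁴, one has (W_ϕ ∩ Δ_ϕ)° = W_ϕ° + Δ_ϕ° = span{ε_2 + R·cos ϕ·ε_4, ε_1 − R·cos ϕ·ε_3, ε_2 − R·sin ϕ·ε_3}, and this subspace of (ℝ⁴)* has dimension 3. -/
/-- The standard basis vector `e_i` of `ℝ⁴` (indices `0,…,3` correspond to the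
coordinates `x, y, θ, ϕ` of the vertical rolling disk). -/
noncomputable def e4 (i : Fin 4) : Fin 4 → ℝ := Pi.single i 1

/-- The dual basis functional `ε_i` on `ℝ⁴`, i.e. `ε_i (u) = u i`. -/
noncomputable def eps4 (i : Fin 4) : Module.Dual ℝ (Fin 4 → ℝ) := LinearMap.proj i

/-- The rolling constraint distribution of the vertical rolling disk at heading angle `ϕ`:
`Δ_ϕ = span {e₃ + R cos ϕ · e₁ + R sin ϕ · e₂, e₄}` (`0`-based indices). -/
noncomputable def diskΔ (R φ : ℝ) : Submodule ℝ (Fin 4 → ℝ) :=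
  Submodule.span ℝ {e4 2 + (R * Real.cos φ) • e4 0 + (R * Real.sin φ) • e4 1, e4 3}

/-- The tangent space to the wall at a boundary point with heading angle `ϕ`:
`W_ϕ = span {e₁, e₃, e₄ − R cos ϕ · e₂}` (`0`-based indices). -/
noncomputable def diskW (R φ : ℝ) : Submodule ℝ (Fin 4 → ℝ) :=
  Submodule.span ℝ {e4 0, e4 2, e4 3 - (R * Real.cos φ) • e4 1}

theorem mem_dualAnnihilator_span_iff {R M : Type*} [CommSemiring R] [AddCommMonoid M]
    [Module R M] (s : Set M) (ζ : Module.Dual R M) :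
    ζ ∈ (Submodule.span R s).dualAnnihilator ↔ ∀ v ∈ s, ζ v = 0 := by
  rw [Submodule.mem_dualAnnihilator]
  refine ⟨fun h v hv => h v (Submodule.subset_span hv), fun h v hv => ?_⟩
  exact (Submodule.span_le (p := LinearMap.ker ζ)).2 h hv

theorem eps4_apply_e4 (i j : Fin 4) : eps4 i (e4 j) = if i = j then 1 else 0 := by
  simp [eps4, e4, Pi.single_apply]

theorem dual_ext_e4 {ζ η : Module.Dual ℝ (Fin 4 → ℝ)} (h : ∀ i, ζ (e4 i) = η (e4 i)) :
    ζ = η :=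
  (Pi.basisFun ℝ (Fin 4)).ext fun i => by simpa [e4] using h i

theorem diskW_dualAnnihilator (R φ : ℝ) :
    (diskW R φ).dualAnnihilator =
      Submodule.span ℝ {eps4 1 + (R * Real.cos φ) • eps4 3} := by
  ext ζ
  rw [diskW, mem_dualAnnihilator_span_iff, Submodule.mem_span_singleton]
  simp only [Set.mem_insert_iff, Set.mem_singleton_iff, forall_eq_or_imp, forall_eq, map_sub,
    map_smul, smul_eq_mul]
  constructor
  · rintro ⟨h0, h2, h3⟩
    refine ⟨ζ (e4 1), dual_ext_e4 fun i => ?_⟩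
    fin_cases i <;> simp [eps4_apply_e4, h0, h2]
    linarith
  · rintro ⟨a, rfl⟩
    simp [eps4_apply_e4]
    ring

theorem diskΔ_dualAnnihilator (R φ : ℝ) :
    (diskΔ R φ).dualAnnihilator =
      Submodule.span ℝ {eps4 0 - (R * Real.cos φ) • eps4 2,
        eps4 1 - (R * Real.sin φ) • eps4 2} := by
  ext ζ
  rw [diskΔ, mem_dualAnnihilator_span_iff, Submodule.mem_span_pair]
  simp only [Set.mem_insert_iff, Set.mem_singleton_iff, forall_eq_or_imp, forall_eq, map_add,
    map_smul, smul_eq_mul]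
  constructor
  · rintro ⟨h2, h3⟩
    refine ⟨ζ (e4 0), ζ (e4 1), dual_ext_e4 fun i => ?_⟩
    fin_cases i <;> simp [eps4_apply_e4, h3]
    linarith
  · rintro ⟨a, b, rfl⟩
    simp [eps4_apply_e4]
    ring

theorem linearIndependent_disk_impulses {R : ℝ} (hR : R ≠ 0) (φ : ℝ) :
    LinearIndependent ℝ ![eps4 1 + (R * Real.cos φ) • eps4 3,
      eps4 0 - (R * Real.cos φ) • eps4 2, eps4 1 - (R * Real.sin φ) • eps4 2] := by
  rw [Fintype.linearIndependent_iff]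
  intro g hg
  have key (i : Fin 4) := LinearMap.congr_fun hg (e4 i)
  have k0 := key 0
  have k1 := key 1
  have k2 := key 2
  have k3 := key 3
  simp [Fin.sum_univ_three, eps4_apply_e4] at k0 k1 k2 k3
  have hg2 : g 2 = -g 0 := by linarith
  have h0 : g 0 = 0 := by
    simp only [k0, hg2, hR] at k2 k3
    by_contra h
    have hs : Real.sin φ = 0 := by simpa [h, hR] using k2
    have hc : Real.cos φ = 0 := by simpa [h, hR] using k3
    simpa [hs, hc] using Real.sin_sq_add_cos_sq φ
  intro i
  fin_cases i <;> simp [h0, hg2, k0]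

/-- **Impulse space at the impact for the vertical rolling disk.** For every `R > 0` and
heading angle `ϕ`, one has `(W_ϕ ∩ Δ_ϕ)° = W_ϕ° + Δ_ϕ°
= span {ε₂ + R cos ϕ · ε₄, ε₁ − R cos ϕ · ε₃, ε₂ − R sin ϕ · ε₃}`, a subspace of
`(ℝ⁴)*` of dimension `3`. -/
theorem rolling_disk_impulse_space (R φ : ℝ) (hR : 0 < R) :
    (diskW R φ ⊓ diskΔ R φ).dualAnnihilator =
        (diskW R φ).dualAnnihilator ⊔ (diskΔ R φ).dualAnnihilator ∧
      (diskW R φ ⊓ diskΔ R φ).dualAnnihilator =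
        Submodule.span ℝ
          {eps4 1 + (R * Real.cos φ) • eps4 3,
           eps4 0 - (R * Real.cos φ) • eps4 2,
           eps4 1 - (R * Real.sin φ) • eps4 2} ∧
      Module.finrank ℝ ((diskW R φ ⊓ diskΔ R φ).dualAnnihilator) = 3 := by
  have hspan : (diskW R φ ⊓ diskΔ R φ).dualAnnihilator =
      Submodule.span ℝ
        {eps4 1 + (R * Real.cos φ) • eps4 3,
         eps4 0 - (R * Real.cos φ) • eps4 2,
         eps4 1 - (R * Real.sin φ) • eps4 2} := by
    rw [Subspace.dualAnnihilator_inf_eq, diskW_dualAnnihilator, diskΔ_dualAnnihilator,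
      ← Submodule.span_union, Set.singleton_union]
  refine ⟨Subspace.dualAnnihilator_inf_eq _ _, hspan, ?_⟩
  have hcard := finrank_span_eq_card (linearIndependent_disk_impulses hR.ne' φ)
  rw [Matrix.range_cons, Matrix.range_cons_cons_empty, Set.singleton_union] at hcard
  rw [hspan, hcard, Fintype.card_fin]
end

section
/- Orthogonal impact of the rolling disk with the wall. Let m, I, J, R > 0 and let v_x^±, v_y^±, v_θ^±, v_ϕ^±, p_x^±, p_y^±, p_θ^±, p_ϕ^± be real numbers (pre-impact quantities carry the superscript −, post-impact quantities the superscript +). Assume: (Legendre relations) p_x^± = m·v_x^±, p_y^± = m·v_y^±, p_θ^± = I·v_θ^±, p_ϕ^± = J·v_ϕ^±; (nonholonomic constraint at heading angle ϕ = π/2) v_x^± = 0 and v_y^± = R·v_θ^±; (momentum jump conditions at ϕ = π/2) there exist λ⁰, λ¹, λ² ∈ ℝ with p_x⁺ − p_x⁻ = λ¹, p_y⁺ − p_y⁻ = λ⁰ + λ², p_θ⁺ − p_θ⁻ = −λ²·R, and p_ϕ⁺ − p_ϕ⁻ = 0; (conservation of energy) m·((v_x⁻)² + (v_y⁻)²)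 + I·(v_θ⁻)² + J·(v_ϕ⁻)² = m·((v_x⁺)² + (v_y⁺)²) + I·(v_θ⁺)² + J·(v_ϕ⁺)²; and (admissibility) v_y⁻ > 0 (the disk approaches the wall) and v_y⁺ ≤ 0 (after the impact the disk does not move into the wall). Then the impact is uniquely determined: p_x⁺ = p_x⁻ = 0, p_y⁺ = −p_y⁻, p_θ⁺ = −p_θ⁻, and p_ϕ⁺ = p_ϕ⁻; moreover v_y⁺ = −v_y⁻ < 0. -/
/-- **Orthogonal impact of the rolling disk with the wall.**
A vertical disk of mass `m`, moments of inertia `I` (rotation) and `J` (heading) and radius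
`R` rolls without slipping and hits a wall orthogonally (heading angle `ϕ = π/2`, so
`cos ϕ = 0`, `sin ϕ = 1`).  Under the Legendre relations, the nonholonomic constraints,
the momentum jump conditions at the impact, conservation of energy and the admissibility
conditions, the impact is uniquely determined:
`pₓ⁺ = pₓ⁻ = 0`, `p_y⁺ = -p_y⁻`, `p_θ⁺ = -p_θ⁻`, `p_ϕ⁺ = p_ϕ⁻`, and `v_y⁺ = -v_y⁻ < 0`. -/
theorem rolling_disk_orthogonal_impact
    (m I J R : ℝ) (hm : 0 < m) (hI : 0 < I) (hJ : 0 < J) (hR : 0 < R)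
    (vxm vym vθm vφm vxp vyp vθp vφp pxm pym pθm pφm pxp pyp pθp pφp : ℝ)
    -- Legendre relations
    (hpxm : pxm = m * vxm) (hpym : pym = m * vym)
    (hpθm : pθm = I * vθm) (hpφm : pφm = J * vφm)
    (hpxp : pxp = m * vxp) (hpyp : pyp = m * vyp)
    (hpθp : pθp = I * vθp) (hpφp : pφp = J * vφp)
    -- nonholonomic constraint at heading angle ϕ = π/2
    (hvxm : vxm = 0) (hvym : vym = R * vθm)
    (hvxp : vxp = 0) (hvyp : vyp = R * vθp)
    -- momentum jump conditions at ϕ = π/2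
    (hjump : ∃ l0 l1 l2 : ℝ, pxp - pxm = l1 ∧ pyp - pym = l0 + l2 ∧
      pθp - pθm = -(l2 * R) ∧ pφp - pφm = 0)
    -- conservation of energy
    (henergy : m * (vxm ^ 2 + vym ^ 2) + I * vθm ^ 2 + J * vφm ^ 2 =
      m * (vxp ^ 2 + vyp ^ 2) + I * vθp ^ 2 + J * vφp ^ 2)
    -- admissibility: the disk approaches the wall and does not move into it afterwards
    (hadm1 : 0 < vym) (hadm2 : vyp ≤ 0) :
    pxp = 0 ∧ pxm = 0 ∧ pyp = -pym ∧ pθp = -pθm ∧ pφp = pφm ∧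
      vyp = -vym ∧ vyp < 0 := by
  obtain ⟨_, _, _, _, _, _, hφ⟩ := hjump
  have hvφ : vφp = vφm := mul_left_cancel₀ hJ.ne' (by linarith)
  subst hvxm hvxp hvφ
  have hvθm : 0 < vθm := pos_of_mul_pos_right (hvym ▸ hadm1) hR.le
  have hvθp : vθp ≤ 0 := nonpos_of_mul_nonpos_right (hvyp ▸ hadm2) hR
  have hfactor : (m * R ^ 2 + I) * ((vθm - vθp) * (vθm + vθp)) = 0 := by
    rw [hvym, hvyp] at henergy
    linear_combination henergy
  have hinertia : m * R ^ 2 + I ≠ 0 := by positivity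
  have hdiff : vθm - vθp ≠ 0 := (by linarith : 0 < vθm - vθp).ne'
  have hsum : vθm + vθp = 0 := by
    simpa [hinertia, hdiff] using hfactor
  have hθ : vθp = -vθm := by linarith
  have hy : vyp = -vym := by rw [hvyp, hvym, hθ, mul_neg]
  refine ⟨by simp [hpxp], by simp [hpxm], ?_, ?_, by linarith, hy, by linarith⟩
  · rw [hpyp, hpym, hy, mul_neg]
  · rw [hpθp, hpθm, hθ, mul_neg]
end
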